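/- arXiv:2604.08533 — 4 statements merged into one kernel-verified Lean document; each statement's English description precedes it below -/
import Mathlib

section
/- Let K be a field of characteristic p > 0, A = K[[Y]] the formal power series ring in one variable, Q(A) its field of fractions, and let M be a ℤⁿ-graded F-finite F-module over R = A[X₁,…,Xₙ]. Then for every u ∈ ℤⁿ there exist natural numbers a(u), b(u), c(u) such that M_u is isomorphic as an A-module to (Q(A)/A)^{a(u)} ⊕ Q(A)^{b(u)} ⊕ A^{c(u)}, where Q(A)/A is isomorphic to the injective hull E(A/YA) of the residue field of A. -/
set_option maxHeartbeats 1000000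
set_option synthInstance.maxHeartbeats 1000000

open scoped TensorProduct

noncomputable section

/-- `R = A[X₁, …, Xₙ]`, the polynomial ring in `n` variables over `A`,
`ℕⁿ`-graded with `A` in degree `0` and `deg Xⱼ = eⱼ`. -/
abbrev PolyR (n : ℕ) (A : Type) [CommRing A] : Type := MvPolynomial (Fin n) A

/-- A polynomial is (multi)homogeneous of degree `d ∈ ℤⁿ` if every monomial occurring in it
has exponent vector `d` (under the grading `deg Xⱼ = eⱼ`). -/
def IsHomog {n : ℕ} {A : Type} [CommRing A] (r : PolyR n A) (d : Fin n → ℤ) : Prop :=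
  ∀ m ∈ r.support, (fun i => ((m i : ℕ) : ℤ)) = d

/-- Type synonym: `R` viewed as an `R`-algebra via the Frobenius `r ↦ r ^ p`. -/
@[nolint unusedArguments]
def FrobTwist (_p n : ℕ) (A : Type) [CommRing A] : Type := PolyR n A

instance (p n : ℕ) (A : Type) [CommRing A] : CommRing (FrobTwist p n A) :=
  inferInstanceAs (CommRing (PolyR n A))

/-- The Frobenius `r ↦ r ^ p`, as a ring homomorphism `R →+* FrobTwist p n A`. -/
def frobToTwist (p n : ℕ) (A : Type) [CommRing A] [Fact p.Prime] [CharP A p] :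
    PolyR n A →+* FrobTwist p n A := frobenius (PolyR n A) p

/-- The `R`-algebra structure on `FrobTwist p n A` given by the Frobenius. -/
instance (p n : ℕ) (A : Type) [CommRing A] [Fact p.Prime] [CharP A p] :
    Algebra (PolyR n A) (FrobTwist p n A) := (frobToTwist p n A).toAlgebra

/-- `F(M) = R ⊗_R M`, the base change of `M` along the Frobenius endomorphism of `R`,
an `R`-module via the left factor. -/
def FF (p n : ℕ) (A : Type) [CommRing A] [Fact p.Prime] [CharP A p]
    (M : Type) [AddCommGroup M] [Module (PolyR n A) M] : Type :=
  FrobTwist p n A ⊗[PolyR n A] M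

section FFInst

variable (p n : ℕ) (A : Type) [CommRing A] [Fact p.Prime] [CharP A p]
variable (M N : Type) [AddCommGroup M] [Module (PolyR n A) M]
  [AddCommGroup N] [Module (PolyR n A) N]

instance : AddCommGroup (FF p n A M) :=
  inferInstanceAs (AddCommGroup (FrobTwist p n A ⊗[PolyR n A] M))

instance : Module (PolyR n A) (FF p n A M) :=
  inferInstanceAs (Module (FrobTwist p n A) (FrobTwist p n A ⊗[PolyR n A] M))

instance : Module A (FF p n A M) :=
  Module.compHom (FF p n A M) (algebraMap A (PolyR n A))

instance : IsScalarTower A (PolyR n A) (FF p n A M) where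
  smul_assoc a r x := by
    show ((a • r) • x : FF p n A M) = (algebraMap A (PolyR n A) a) • (r • x)
    rw [Algebra.smul_def, mul_smul]

/-- Inclusion of elements of the tensor product into `F(M)`. -/
def FF.of (x : FrobTwist p n A ⊗[PolyR n A] M) : FF p n A M := x

/-- An element of `R`, viewed in `FrobTwist p n A`. -/
def twist (r : PolyR n A) : FrobTwist p n A := r

/-- The degree-`u` component of `F(M)` induced by a grading `gr` on `M`:
the `A`-span of the homogeneous tensors `r ⊗ m` with `deg(r ⊗ m) = deg r + p • deg m = u`. -/
def FF.comp [Module A M] (gr : (Fin n → ℤ) → Submodule A M) (u : Fin n → ℤ) :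
    Submodule A (FF p n A M) :=
  Submodule.span A { x : FF p n A M |
    ∃ (r : PolyR n A) (d v : Fin n → ℤ) (m : M),
      IsHomog r d ∧ m ∈ gr v ∧ d + p • v = u ∧
      x = FF.of p n A M (twist p n A r ⊗ₜ[PolyR n A] m) }

/-- Functoriality of `F`. -/
def FF.map {M N} [AddCommGroup M] [Module (PolyR n A) M]
    [AddCommGroup N] [Module (PolyR n A) N] (f : M →ₗ[PolyR n A] N) :
    FF p n A M →ₗ[PolyR n A] FF p n A N :=
  LinearMap.baseChange (FrobTwist p n A) f

end FFInst

/-- A bundled `ℤⁿ`-graded module over `R = A[X₁,…,Xₙ]`: a module together with a family of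
`A`-submodules indexed by `ℤⁿ` (the candidate graded components). -/
structure GrMod (p n : ℕ) (A : Type) [CommRing A] [Fact p.Prime] [CharP A p] : Type 1 where
  carrier : Type
  [acg : AddCommGroup carrier]
  [modA : Module A carrier]
  [modR : Module (PolyR n A) carrier]
  [tower : IsScalarTower A (PolyR n A) carrier]
  gr : (Fin n → ℤ) → Submodule A carrier

attribute [instance] GrMod.acg GrMod.modA GrMod.modR GrMod.tower

variable {p n : ℕ} {A : Type} [CommRing A] [Fact p.Prime] [CharP A p]

/-- The Frobenius functor applied to a bundled graded module, with the induced grading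
`deg(r ⊗ m) = deg r + p • deg m`. -/
def GrMod.F (X : GrMod p n A) : GrMod p n A where
  carrier := FF p n A X.carrier
  gr := FF.comp p n A X.carrier X.gr

/-- Iterates `F^k(X)` of the Frobenius functor on a bundled graded module. -/
def GrMod.FPow (X : GrMod p n A) : ℕ → GrMod p n A
  | 0 => X
  | (k + 1) => (X.FPow k).F

/-- The maps `F^k(β) : F^k(U) → F^(k+1)(U)` of the direct system induced by a generating
morphism `β : U → F(U)`. -/
def GrMod.seqMap (X : GrMod p n A) (β : X.carrier →ₗ[PolyR n A] X.F.carrier) :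
    ∀ k : ℕ, (X.FPow k).carrier →ₗ[PolyR n A] (X.FPow (k + 1)).carrier
  | 0 => β
  | (k + 1) => FF.map p n A (X.seqMap β k)

/-- The composite transition maps `F^k(U) → F^(k+l)(U)` of the direct system. -/
def GrMod.trans (X : GrMod p n A) (β : X.carrier →ₗ[PolyR n A] X.F.carrier) :
    ∀ (k l : ℕ), (X.FPow k).carrier →ₗ[PolyR n A] (X.FPow (k + l)).carrier
  | _, 0 => LinearMap.id
  | k, (l + 1) => (X.seqMap β (k + l)).comp (X.trans β k l)

/-- `M`, together with the family `gr` of its `A`-submodule components, is a `ℤⁿ`-graded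
`F`-finite `F`-module over `R = A[X₁,…,Xₙ]`.  The fields say:
* `gr` is a `ℤⁿ`-grading of `M` by `A`-submodules making `M` a graded `R`-module
  (`isInternal`, `smul_X_mem`);
* `theta : M ≅ F(M)` is a degree-preserving `R`-linear isomorphism (`theta`, `theta_grade`),
  where the grading on `F(M)` is given by `deg (r ⊗ m) = deg r + p • deg m`;
* `M` is the direct limit of `U →β F(U) →F(β) F²(U) → ⋯` for a degree-preserving generating
  morphism `β : U → F(U)` from a finitely generated `ℤⁿ`-graded module `U` (= `gen.carrier`),
  via degree-preserving structure maps `toLim k : F^k(U) → M` (`toLim_compat`, `toLim_grade`,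
  `toLim_surj`, `toLim_ker` say precisely that `M` is the colimit of the system), compatibly
  with `theta` (`theta_compat`). -/
structure ZGradedFFiniteFModule (p n : ℕ) (A : Type) [CommRing A] [Fact p.Prime] [CharP A p]
    (M : Type) [AddCommGroup M] [Module A M] [Module (PolyR n A) M]
    [IsScalarTower A (PolyR n A) M]
    (gr : (Fin n → ℤ) → Submodule A M) : Type 1 where
  isInternal : DirectSum.IsInternal gr
  smul_X_mem : ∀ (i : Fin n) (u : Fin n → ℤ), ∀ m ∈ gr u,
    (MvPolynomial.X i : PolyR n A) • m ∈ gr (u + Pi.single i 1)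
  theta : M ≃ₗ[PolyR n A] FF p n A M
  theta_grade : ∀ (u : Fin n → ℤ), ∀ m ∈ gr u, theta m ∈ FF.comp p n A M gr u
  gen : GrMod p n A
  gen_fg : Module.Finite (PolyR n A) gen.carrier
  gen_internal : DirectSum.IsInternal gen.gr
  gen_smul_X_mem : ∀ (i : Fin n) (u : Fin n → ℤ), ∀ x ∈ gen.gr u,
    (MvPolynomial.X i : PolyR n A) • x ∈ gen.gr (u + Pi.single i 1)
  beta : gen.carrier →ₗ[PolyR n A] gen.F.carrier
  beta_grade : ∀ (u : Fin n → ℤ), ∀ x ∈ gen.gr u, beta x ∈ gen.F.gr u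
  toLim : ∀ k : ℕ, (gen.FPow k).carrier →ₗ[PolyR n A] M
  toLim_compat : ∀ (k : ℕ) (x : (gen.FPow k).carrier),
    toLim (k + 1) (gen.seqMap beta k x) = toLim k x
  toLim_grade : ∀ (k : ℕ) (u : Fin n → ℤ), ∀ x ∈ (gen.FPow k).gr u, toLim k x ∈ gr u
  toLim_surj : ∀ m : M, ∃ (k : ℕ) (x : (gen.FPow k).carrier), toLim k x = m
  toLim_ker : ∀ (k : ℕ) (x : (gen.FPow k).carrier), toLim k x = 0 →
    ∃ l : ℕ, gen.trans beta k l x = 0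
  theta_compat : ∀ (k : ℕ) (x : (gen.FPow k).carrier),
    theta (toLim k x) = FF.map p n A (toLim k) (gen.seqMap beta k x)

/-- The block `B(U) ⊆ ℤⁿ` associated to a subset `U ⊆ {1,…,n}`:
`uᵢ ≥ 0` for `i ∈ U` and `uᵢ ≤ -1` for `i ∉ U`. -/
def Block (n : ℕ) (U : Set (Fin n)) : Set (Fin n → ℤ) :=
  { u | ∀ i : Fin n, (i ∈ U → 0 ≤ u i) ∧ (i ∉ U → u i ≤ -1) }

/-- A ring of characteristic `p` injects its characteristic into power series. -/
instance (K : Type) [Field K] (p : ℕ) [CharP K p] : CharP (PowerSeries K) p :=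
  charP_of_injective_ringHom (PowerSeries.C_injective (R := K)) p

/-- `Q(A)`, the field of fractions of `A = K[[Y]]`. -/
abbrev QA (K : Type) [Field K] : Type := FractionRing (PowerSeries K)

/-- `Q(A)/A`, which is isomorphic to the injective hull `E(A/YA)` of the residue field of
`A = K[[Y]]`. -/
abbrev QmodA (K : Type) [Field K] : Type :=
  (QA K) ⧸ LinearMap.range (Algebra.linearMap (PowerSeries K) (QA K))

section PowerSeriesModules

variable {K : Type} [Field K] {N : Type} [AddCommGroup N] [Module (PowerSeries K) N]

/-- Every `X`-power torsion element is divisible by `X`. -/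
def TorsionXDivisible (K : Type) [Field K] (N : Type) [AddCommGroup N]
    [Module (PowerSeries K) N] : Prop :=
  ∀ (j : ℕ) (t : N), (PowerSeries.X : PowerSeries K) ^ j • t = 0 →
    ∃ s : N, (PowerSeries.X : PowerSeries K) • s = t

/-- A family is `X`-minimal if the coefficients of all of its linear relations are divisible
by `X`, i.e. it is a minimal generating family of its span. -/
def XMinimal (K : Type) [Field K] {N : Type} [AddCommGroup N] [Module (PowerSeries K) N]
    {m : ℕ} (v : Fin m → N) : Prop :=
  ∀ c : Fin m → PowerSeries K, ∑ i, c i • v i = 0 → ∀ i, PowerSeries.X ∣ c i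

/-- All finitely generated submodules have at most `g` minimal generators. -/
def XRankLE (K : Type) [Field K] (g : ℕ) (N : Type) [AddCommGroup N]
    [Module (PowerSeries K) N] : Prop :=
  ∀ (m : ℕ) (v : Fin m → N), XMinimal K v → m ≤ g

theorem PowerSeries.exists_unit_mul_X_pow {a : PowerSeries K} (ha : a ≠ 0) :
    ∃ (k : ℕ) (u : (PowerSeries K)ˣ), a = (u : PowerSeries K) * PowerSeries.X ^ k :=
  IsDiscreteValuationRing.eq_unit_mul_pow_irreducible ha PowerSeries.X_irreducible

theorem PowerSeries.isUnit_of_not_X_dvd {a : PowerSeries K} (ha : ¬ PowerSeries.X ∣ a) :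
    IsUnit a := by
  obtain ⟨k, u, rfl⟩ := PowerSeries.exists_unit_mul_X_pow (a := a) (by rintro rfl; simp at ha)
  cases k with
  | zero => simp
  | succ k => exact absurd ⟨(u : PowerSeries K) * PowerSeries.X ^ k, by ring⟩ ha

theorem exists_pow_X_smul_eq (hN : ∀ d : N, ∃ d' : N, (PowerSeries.X : PowerSeries K) • d' = d)
    (k : ℕ) (d : N) : ∃ d' : N, (PowerSeries.X : PowerSeries K) ^ k • d' = d := by
  induction k with
  | zero => exact ⟨d, by simp⟩
  | succ k ih =>
    obtain ⟨e, he⟩ := ih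
    obtain ⟨e', rfl⟩ := hN e
    exact ⟨e', by rw [pow_succ, mul_smul, he]⟩

/-- An `X`-divisible module over `K⟦X⟧` is injective. -/
theorem baer_of_X_divisible
    (hN : ∀ d : N, ∃ d' : N, (PowerSeries.X : PowerSeries K) • d' = d) :
    Module.Baer (PowerSeries K) N := by
  intro I g
  obtain ⟨a, rfl⟩ := (IsPrincipalIdealRing.principal I).principal
  by_cases ha : a = 0
  · subst ha
    refine ⟨0, fun x hx => ?_⟩
    have : (⟨x, hx⟩ : ↥(Submodule.span (PowerSeries K) {(0 : PowerSeries K)})) = 0 := by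
      ext1; simpa using hx
    rw [this]; simp
  · obtain ⟨k, u, hu⟩ := PowerSeries.exists_unit_mul_X_pow ha
    obtain ⟨d, hd⟩ := exists_pow_X_smul_eq hN k
      ((↑u⁻¹ : PowerSeries K) • g ⟨a, Submodule.mem_span_singleton_self a⟩)
    refine ⟨LinearMap.toSpanSingleton _ _ d, fun x hx => ?_⟩
    obtain ⟨b, rfl⟩ := Submodule.mem_span_singleton.1 hx
    have h1 : (⟨b • a, hx⟩ : ↥(Submodule.span (PowerSeries K) {a})) =
        b • ⟨a, Submodule.mem_span_singleton_self a⟩ := rfl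
    rw [h1, map_smul g, LinearMap.toSpanSingleton_apply, smul_assoc]
    congr 1
    generalize g ⟨a, Submodule.mem_span_singleton_self a⟩ = z at hd ⊢
    rw [hu, mul_smul, hd, ← mul_smul]
    simp

/-- The submodule of infinitely `X`-divisible elements. -/
def XInfDivisible (K : Type) [Field K] (N : Type) [AddCommGroup N]
    [Module (PowerSeries K) N] : Submodule (PowerSeries K) N where
  carrier := {x | ∀ k : ℕ, ∃ y : N, (PowerSeries.X : PowerSeries K) ^ k • y = x}
  add_mem' := by
    intro a b ha hb k
    obtain ⟨x, rfl⟩ := ha k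
    obtain ⟨y, rfl⟩ := hb k
    exact ⟨x + y, smul_add _ _ _⟩
  zero_mem' := fun k => ⟨0, smul_zero _⟩
  smul_mem' := by
    intro c a ha k
    obtain ⟨x, rfl⟩ := ha k
    exact ⟨c • x, smul_comm _ _ _⟩

theorem TorsionXDivisible.mem_XInfDivisible (h : TorsionXDivisible K N) {j : ℕ} {t : N}
    (ht : (PowerSeries.X : PowerSeries K) ^ j • t = 0) : t ∈ XInfDivisible K N := by
  intro k
  induction k generalizing j t with
  | zero => exact ⟨t, by simp⟩
  | succ k ih =>
    obtain ⟨s, rfl⟩ := h j t ht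
    obtain ⟨y, rfl⟩ := ih (j := j + 1) (t := s) (by rwa [pow_succ, mul_smul])
    exact ⟨y, by rw [pow_succ', mul_smul]⟩

theorem TorsionXDivisible.XInfDivisible_divisible (h : TorsionXDivisible K N)
    (d : XInfDivisible K N) :
    ∃ d' : XInfDivisible K N, (PowerSeries.X : PowerSeries K) • d' = d := by
  obtain ⟨d, hd⟩ := d
  obtain ⟨e, he⟩ := hd 1
  rw [pow_one] at he
  refine ⟨⟨e, fun k => ?_⟩, Subtype.ext he⟩
  obtain ⟨y, hy⟩ := hd (k + 1)
  obtain ⟨z, hz⟩ := h.mem_XInfDivisible (j := 1)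
    (t := e - (PowerSeries.X : PowerSeries K) ^ k • y)
    (by rw [pow_one, smul_sub, he, ← mul_smul, ← pow_succ', hy, sub_self]) k
  exact ⟨y + z, by rw [smul_add, hz]; abel⟩

theorem XRankLE.of_finite_subsets {g : ℕ}
    (h : ∀ (m : ℕ) (v : Fin m → N), ∃ w : Fin g → N,
      ∀ i, v i ∈ Submodule.span (PowerSeries K) (Set.range w)) : XRankLE K g N := by
  intro m v hv
  obtain ⟨w, hw⟩ := h m v
  simp_rw [Submodule.mem_span_range_iff_exists_fun] at hw
  choose P hP using hw
  let L : (Fin m → PowerSeries K) →ₗ[PowerSeries K] (Fin g → PowerSeries K) :=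
    Fintype.linearCombination (PowerSeries K) P
  have hdvd : ∀ c, L c = 0 → ∀ i, PowerSeries.X ∣ c i := by
    intro c hc
    apply hv
    have : ∀ j, ∑ i, c i * P i j = 0 := by
      intro j
      have := congrFun hc j
      simpa [L, Fintype.linearCombination_apply] using this
    simp_rw [← hP, Finset.smul_sum, ← mul_smul]
    rw [Finset.sum_comm]
    simp_rw [← Finset.sum_smul, this, zero_smul, Finset.sum_const_zero]
  have hpow : ∀ (k : ℕ) c, L c = 0 → ∀ i, PowerSeries.X ^ k ∣ c i := by
    intro k
    induction k with
    | zero => intro c _ i; simp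
    | succ k ih =>
      intro c hc
      choose d hd using hdvd c hc
      have hcd : c = (PowerSeries.X : PowerSeries K) • d := funext hd
      have hLd : L d = 0 := by
        rw [hcd, map_smul] at hc
        exact (smul_eq_zero.1 hc).resolve_left PowerSeries.X_ne_zero
      intro i
      rw [hd i, pow_succ']
      exact mul_dvd_mul_left _ (ih d hLd i)
  apply le_of_fin_injective (PowerSeries K) L
  rw [injective_iff_map_eq_zero]
  intro c hc
  ext i n
  exact PowerSeries.X_pow_dvd_iff.1 (hpow (n + 1) c hc i) n (Nat.lt_succ_self n)

/-- A separated module with finite rank and no torsion is free. -/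
theorem free_of_XInfDivisible_eq_bot {g : ℕ} (hg : XRankLE K g N)
    (ht : ∀ t : N, (PowerSeries.X : PowerSeries K) • t = 0 → t = 0)
    (hs : XInfDivisible K N = ⊥) :
    ∃ c : ℕ, Nonempty (N ≃ₗ[PowerSeries K] (Fin c → PowerSeries K)) := by
  classical
  let P : ℕ → Prop := fun m => ∃ v : Fin m → N, ∀ c : Fin m → PowerSeries K,
    (∃ y : N, ∑ i, c i • v i = (PowerSeries.X : PowerSeries K) • y) → ∀ i, PowerSeries.X ∣ c i
  have hP0 : P 0 := ⟨Fin.elim0, fun c _ i => i.elim0⟩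
  have hPg : ∀ m, P m → m ≤ g := by
    rintro m ⟨v, hv⟩
    exact hg m v fun c hc => hv c ⟨0, by rw [hc, smul_zero]⟩
  let m := Nat.findGreatest P g
  have hPm : P m := Nat.findGreatest_spec (P := P) (Nat.zero_le g) hP0
  have hmax : ¬ P (m + 1) := fun h =>
    absurd (Nat.le_findGreatest (P := P) (hPg _ h) h) (by simp [m])
  obtain ⟨v, hv⟩ := hPm
  let f : (Fin m → PowerSeries K) →ₗ[PowerSeries K] N :=
    Fintype.linearCombination (PowerSeries K) v
  have hf : ∀ c, f c = ∑ i, c i • v i := fun c => Fintype.linearCombination_apply _ _ _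
  have hsep : ∀ x : N, (∀ k : ℕ, ∃ y : N, (PowerSeries.X : PowerSeries K) ^ k • y = x) →
      x = 0 := by
    intro x hx
    have : x ∈ XInfDivisible K N := hx
    rwa [hs, Submodule.mem_bot] at this
  have hgen : ∀ y : N, ∃ (α : Fin m → K) (y' : N),
      y = f (fun i => PowerSeries.C (α i)) + (PowerSeries.X : PowerSeries K) • y' := by
    intro y
    have hgen' : ∃ (a : Fin m → PowerSeries K) (y' : N),
        y = f a + (PowerSeries.X : PowerSeries K) • y' := by
      by_contra hcon
      apply hmax
      refine ⟨Fin.cons y v, fun c hc => ?_⟩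
      obtain ⟨z, hz⟩ := hc
      rw [Fin.sum_univ_succ] at hz
      simp only [Fin.cons_zero, Fin.cons_succ] at hz
      have h0 : PowerSeries.X ∣ c 0 := by
        by_contra h0
        obtain ⟨u, hu⟩ := PowerSeries.isUnit_of_not_X_dvd h0
        apply hcon
        refine ⟨(-(↑u⁻¹ : PowerSeries K)) • fun i => c i.succ, (↑u⁻¹ : PowerSeries K) • z, ?_⟩
        rw [map_smul, hf, smul_comm (PowerSeries.X : PowerSeries K), ← hz, ← hu, smul_add,
          ← mul_smul, Units.inv_mul, one_smul, neg_smul]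
        abel
      obtain ⟨d, hd⟩ := h0
      have hsucc := hv (fun i => c i.succ) ⟨z - d • y, by
        rw [smul_sub, ← hz, hd, mul_smul]; abel⟩
      intro i
      refine Fin.cases ⟨d, hd⟩ hsucc i
    obtain ⟨a, y', rfl⟩ := hgen'
    have hdec : ∀ i, ∃ b : PowerSeries K,
        a i = PowerSeries.C (PowerSeries.constantCoeff (a i)) + PowerSeries.X * b := by
      intro i
      obtain ⟨b, hb⟩ := PowerSeries.X_dvd_iff.2
        (show PowerSeries.constantCoeff
          (a i - PowerSeries.C (PowerSeries.constantCoeff (a i))) = 0 by simp)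
      exact ⟨b, by rw [← hb]; ring⟩
    choose b hb using hdec
    refine ⟨fun i => PowerSeries.constantCoeff (a i), y' + f b, ?_⟩
    have : a = (fun i => PowerSeries.C (PowerSeries.constantCoeff (a i))) +
        (PowerSeries.X : PowerSeries K) • b := funext hb
    rw [smul_add, ← map_smul, add_comm _ (f _), ← add_assoc, ← map_add, ← this]
  choose α y' hy' using hgen
  have hsurj : Function.Surjective f := by
    intro y
    let s : ℕ → N := fun n => y'^[n] y
    have hs' : ∀ n, s n = f (fun i => PowerSeries.C (α (s n) i)) +
        (PowerSeries.X : PowerSeries K) • s (n + 1) := by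
      intro n
      simp only [s, Function.iterate_succ_apply']
      exact hy' _
    let c : ℕ → Fin m → PowerSeries K := fun n i => PowerSeries.mk fun k => α (s (n + k)) i
    have hc : ∀ n, c n = (fun i => PowerSeries.C (α (s n) i)) +
        (PowerSeries.X : PowerSeries K) • c (n + 1) := by
      intro n
      ext i k
      cases k with
      | zero => simp [c]
      | succ k =>
        simp [c, PowerSeries.coeff_succ_X_mul, add_assoc, add_comm 1 k]
    refine ⟨c 0, ?_⟩
    have hdiff : ∀ n, f (c 0) - y =
        (PowerSeries.X : PowerSeries K) ^ n • (f (c n) - s n) := by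
      intro n
      induction n with
      | zero => simp [s]
      | succ n ih =>
        have h1 : f (c n) = f (fun i => PowerSeries.C (α (s n) i)) +
            (PowerSeries.X : PowerSeries K) • f (c (n + 1)) := by
          rw [← map_smul, ← map_add, ← hc]
        have h2 := hs' n
        generalize f (fun i => PowerSeries.C (α (s n) i)) = z at h1 h2
        rw [ih, pow_succ, mul_smul, h1, h2, add_sub_add_left_eq_sub,
          smul_sub (PowerSeries.X : PowerSeries K)]
    exact sub_eq_zero.1 (hsep _ fun k => ⟨_, (hdiff k).symm⟩)
  have hinj : Function.Injective f := by
    rw [injective_iff_map_eq_zero]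
    have hpow : ∀ (k : ℕ) c, f c = 0 → ∀ i, PowerSeries.X ^ k ∣ c i := by
      intro k
      induction k with
      | zero => intro c _ i; simp
      | succ k ih =>
        intro c hc
        choose d hd using hv c ⟨0, by rw [← hf, hc, smul_zero]⟩
        have hcd : c = (PowerSeries.X : PowerSeries K) • d := funext hd
        have hLd : f d = 0 := by
          rw [hcd, map_smul] at hc
          exact ht _ hc
        intro i
        rw [hd i, pow_succ']
        exact mul_dvd_mul_left _ (ih d hLd i)
    intro c hc
    ext i n
    exact PowerSeries.X_pow_dvd_iff.1 (hpow (n + 1) c hc i) n (Nat.lt_succ_self n)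
  exact ⟨m, ⟨(LinearEquiv.ofBijective f ⟨hinj, hsurj⟩).symm⟩⟩

/-- An injective submodule generated by the image of `Q(A)` splits off, and the rank of the
complement drops. -/
theorem exists_splitting {g : ℕ} (hN : TorsionXDivisible K N) (hg : XRankLE K g N)
    (h : FractionRing (PowerSeries K) →ₗ[PowerSeries K] N) (h0 : h ≠ 0) :
    ∃ g' : ℕ, g = g' + 1 ∧ ∃ N' : Submodule (PowerSeries K) N,
      TorsionXDivisible K N' ∧ XRankLE K g' N' ∧
      Nonempty (N ≃ₗ[PowerSeries K] (FractionRing (PowerSeries K) ⧸ LinearMap.ker h) × N') := by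
  have hdiv : ∀ d : LinearMap.range h, ∃ d' : LinearMap.range h,
      (PowerSeries.X : PowerSeries K) • d' = d := by
    rintro ⟨_, q, rfl⟩
    refine ⟨⟨h (q / algebraMap (PowerSeries K) _ PowerSeries.X), _, rfl⟩, ?_⟩
    ext1
    change (PowerSeries.X : PowerSeries K) • h _ = h q
    rw [← map_smul, Algebra.smul_def, mul_div_cancel₀]
    simp [PowerSeries.X_ne_zero]
  obtain ⟨r, hr⟩ := (baer_of_X_divisible hdiv).extension_property (LinearMap.range h).subtype
    (Submodule.subtype_injective _) LinearMap.id
  have hr' : ∀ x : LinearMap.range h, r x = x := fun x => LinearMap.congr_fun hr x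
  obtain ⟨e, he, he0⟩ : ∃ e : N, e ∈ LinearMap.range h ∧ e ≠ 0 := by
    by_contra hcon
    push Not at hcon
    exact h0 (LinearMap.ext fun q => hcon _ ⟨q, rfl⟩)
  have hbound : ∀ (m : ℕ) (v : Fin m → LinearMap.ker r), XMinimal K v → m + 1 ≤ g := by
    intro m v hv
    apply hg (m + 1) (Fin.cons e fun i => (v i : N))
    intro c hc
    rw [Fin.sum_univ_succ] at hc
    simp only [Fin.cons_zero, Fin.cons_succ] at hc
    have hsum : ∑ i : Fin m, c i.succ • (v i : N) =
        ((∑ i : Fin m, c i.succ • v i : LinearMap.ker r) : N) := by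
      simp
    have h1 : c 0 • e = 0 := by
      have h2 := congrArg r hc
      rw [hsum, map_add, map_zero, LinearMap.mem_ker.1 (Subtype.property _), add_zero,
        map_smul, hr' ⟨e, he⟩] at h2
      exact congrArg Subtype.val h2
    rw [h1, zero_add, hsum] at hc
    have h2 := hv (fun i => c i.succ) (Subtype.ext hc)
    intro i
    refine Fin.cases ?_ h2 i
    by_contra h3
    obtain ⟨u, hu⟩ := PowerSeries.isUnit_of_not_X_dvd h3
    apply he0
    rw [← one_smul (PowerSeries K) e, ← Units.inv_mul u, mul_smul, hu, h1, smul_zero]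
  have hg1 : 1 ≤ g := by
    simpa using hbound 0 Fin.elim0 (fun c _ i => i.elim0)
  refine ⟨g - 1, by omega, LinearMap.ker r, ?_, ?_, ?_⟩
  · rintro j ⟨t, ht⟩ hjt
    obtain ⟨s, rfl⟩ := hN j t (congrArg Subtype.val hjt)
    have hs : s - r s ∈ LinearMap.ker r := by
      rw [LinearMap.mem_ker, map_sub, hr', sub_self]
    refine ⟨⟨s - r s, hs⟩, ?_⟩
    ext1
    change (PowerSeries.X : PowerSeries K) • (s - (r s : N)) = (PowerSeries.X : PowerSeries K) • s
    have h1 : (PowerSeries.X : PowerSeries K) • r s = 0 := by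
      rw [← map_smul]; exact ht
    have h2 := congrArg Subtype.val h1
    rw [smul_sub]
    rw [Submodule.coe_smul, Submodule.coe_zero] at h2
    rw [h2, sub_zero]
  · intro m v hv
    have := hbound m v hv
    omega
  · exact ⟨((Submodule.prodEquivOfIsCompl _ _ (LinearMap.isCompl_of_proj hr')).symm).trans
      (h.quotKerEquivRange.symm.prodCongr (LinearEquiv.refl _ _))⟩

theorem exists_hom_fractionRing (hN : TorsionXDivisible K N) (hs : XInfDivisible K N ≠ ⊥) :
    ∃ h : FractionRing (PowerSeries K) →ₗ[PowerSeries K] N, h ≠ 0 ∧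
      (LinearMap.ker h = ⊥ ∨ LinearMap.ker h =
        LinearMap.range (Algebra.linearMap (PowerSeries K) (FractionRing (PowerSeries K)))) := by
  have hext : ∀ x ∈ XInfDivisible K N,
      ∃ h : FractionRing (PowerSeries K) →ₗ[PowerSeries K] N, h 1 = x := by
    intro x hx
    obtain ⟨h, hh⟩ := (baer_of_X_divisible hN.XInfDivisible_divisible).extension_property
      (Algebra.linearMap (PowerSeries K) (FractionRing (PowerSeries K)))
      (IsFractionRing.injective _ _)
      (LinearMap.toSpanSingleton _ _ (⟨x, hx⟩ : XInfDivisible K N))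
    refine ⟨(XInfDivisible K N).subtype ∘ₗ h, ?_⟩
    have h1 := LinearMap.congr_fun hh 1
    simp only [LinearMap.comp_apply, Algebra.linearMap_apply, map_one,
      LinearMap.toSpanSingleton_apply, one_smul] at h1
    simp [h1]
  have hX : algebraMap (PowerSeries K) (FractionRing (PowerSeries K)) PowerSeries.X ≠ 0 := by
    simp [PowerSeries.X_ne_zero]
  by_cases htor : ∃ t : N, t ≠ 0 ∧ (PowerSeries.X : PowerSeries K) • t = 0
  · obtain ⟨t, ht0, ht⟩ := htor
    obtain ⟨h, hh⟩ := hext t (hN.mem_XInfDivisible (j := 1) (by rwa [pow_one]))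
    let h' := h ∘ₗ LinearMap.lsmul (PowerSeries K) (FractionRing (PowerSeries K)) PowerSeries.X
    have hh' : ∀ q, h' q = h (algebraMap (PowerSeries K) _ PowerSeries.X * q) := by
      intro q
      simp [h', Algebra.smul_def]
    have h1 : h' 1 = 0 := by
      rw [hh', ← Algebra.smul_def, map_smul, hh, ht]
    have h2 : h' (algebraMap (PowerSeries K) _ PowerSeries.X)⁻¹ = t := by
      rw [hh', mul_inv_cancel₀ hX, hh]
    refine ⟨h', ?_, Or.inr ?_⟩
    · intro h3
      rw [h3] at h2
      exact ht0 h2.symm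
    · ext q
      rw [LinearMap.mem_ker, LinearMap.mem_range]
      constructor
      · intro hq
        obtain ⟨a, b, hb, rfl⟩ := IsFractionRing.div_surjective (A := PowerSeries K) q
        by_contra hcon
        have ha : a ≠ 0 := by
          rintro rfl
          exact hcon ⟨0, by simp⟩
        obtain ⟨k, u, rfl⟩ := PowerSeries.exists_unit_mul_X_pow ha
        obtain ⟨l, w, rfl⟩ := PowerSeries.exists_unit_mul_X_pow (nonZeroDivisors.ne_zero hb)
        have hw : algebraMap (PowerSeries K) (FractionRing (PowerSeries K)) w ≠ 0 := by
          simp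
        have hu : algebraMap (PowerSeries K) (FractionRing (PowerSeries K)) u ≠ 0 := by
          simp
        have hwi : algebraMap (PowerSeries K) (FractionRing (PowerSeries K)) ↑w⁻¹ =
            (algebraMap (PowerSeries K) (FractionRing (PowerSeries K)) w)⁻¹ := by
          exact eq_inv_of_mul_eq_one_left (by rw [← map_mul, Units.inv_mul, map_one])
        have hui : algebraMap (PowerSeries K) (FractionRing (PowerSeries K)) ↑u⁻¹ =
            (algebraMap (PowerSeries K) (FractionRing (PowerSeries K)) u)⁻¹ := by
          exact eq_inv_of_mul_eq_one_left (by rw [← map_mul, Units.inv_mul, map_one])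
        by_cases hkl : l ≤ k
        · obtain ⟨d, rfl⟩ := Nat.exists_eq_add_of_le hkl
          apply hcon
          refine ⟨(u : PowerSeries K) * ((w⁻¹ : (PowerSeries K)ˣ) : PowerSeries K) *
            PowerSeries.X ^ d, ?_⟩
          simp only [Algebra.linearMap_apply, map_mul, map_pow, hwi]
          field_simp
          ring
        · obtain ⟨d, rfl⟩ := Nat.exists_eq_add_of_lt (not_le.1 hkl)
          apply ht0
          rw [← h2]
          have h4 : (algebraMap (PowerSeries K) (FractionRing (PowerSeries K)) PowerSeries.X)⁻¹ =
              ((w : PowerSeries K) * ((u⁻¹ : (PowerSeries K)ˣ) : PowerSeries K) *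
                PowerSeries.X ^ d) •
              (algebraMap (PowerSeries K) (FractionRing (PowerSeries K))
                ((u : PowerSeries K) * PowerSeries.X ^ k) /
              algebraMap (PowerSeries K) (FractionRing (PowerSeries K))
                ((w : PowerSeries K) * PowerSeries.X ^ (k + d + 1))) := by
            simp only [Algebra.smul_def, map_mul, map_pow, hui]
            field_simp
            ring
          rw [h4, map_smul, hq, smul_zero]
      · rintro ⟨a, rfl⟩
        rw [Algebra.linearMap_apply, ← mul_one (algebraMap _ _ a), ← Algebra.smul_def, map_smul,
          h1, smul_zero]
  · push Not at htor
    obtain ⟨x, hx, hx0⟩ := (Submodule.ne_bot_iff _).1 hs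
    obtain ⟨h, hh⟩ := hext x hx
    have htf : ∀ a : PowerSeries K, a ≠ 0 → a • x ≠ 0 := by
      intro a ha hax
      obtain ⟨k, u, rfl⟩ := PowerSeries.exists_unit_mul_X_pow ha
      have h1 : (PowerSeries.X : PowerSeries K) ^ k • x = 0 := by
        rw [← one_smul (PowerSeries K) (_ • x), ← Units.inv_mul u, mul_smul,
          ← mul_smul (u : PowerSeries K), hax, smul_zero]
      clear hax ha
      induction k with
      | zero => exact hx0 (by simpa using h1)
      | succ k ih =>
        apply ih
        by_contra h2
        exact htor _ h2 (by rw [← mul_smul, ← pow_succ', h1])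
    refine ⟨h, ?_, Or.inl ?_⟩
    · rintro rfl
      exact hx0 hh.symm
    · rw [LinearMap.ker_eq_bot']
      intro q hq
      obtain ⟨a, b, hb, rfl⟩ := IsFractionRing.div_surjective (A := PowerSeries K) q
      by_cases ha : a = 0
      · simp [ha]
      · exfalso
        apply htf a ha
        have hb0 : algebraMap (PowerSeries K) (FractionRing (PowerSeries K)) b ≠ 0 := by
          simpa using nonZeroDivisors.ne_zero hb
        rw [← hh, ← map_smul, Algebra.smul_def, mul_one]
        have h3 : algebraMap (PowerSeries K) (FractionRing (PowerSeries K)) a = b •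
            (algebraMap (PowerSeries K) (FractionRing (PowerSeries K)) a /
              algebraMap (PowerSeries K) (FractionRing (PowerSeries K)) b) := by
          rw [Algebra.smul_def, mul_div_cancel₀ _ hb0]
        rw [h3, map_smul, hq, smul_zero]

/-- Moving the first factor of a fourfold product past the second one. -/
def prodRotateEquiv (S N₁ N₂ N₃ N₄ : Type*) [Semiring S] [AddCommMonoid N₁] [Module S N₁]
    [AddCommMonoid N₂] [Module S N₂] [AddCommMonoid N₃] [Module S N₃]
    [AddCommMonoid N₄] [Module S N₄] :
    (N₁ × N₂ × N₃ × N₄) ≃ₗ[S] N₂ × (N₁ × N₃) × N₄ where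
  toFun x := (x.2.1, (x.1, x.2.2.1), x.2.2.2)
  invFun x := (x.2.1.1, x.1, x.2.1.2, x.2.2)
  map_add' _ _ := rfl
  map_smul' _ _ := rfl
  left_inv _ := rfl
  right_inv _ := rfl

/-- Structure of modules of finite rank over `K⟦X⟧` whose torsion is divisible. -/
theorem exists_equiv_of_XRankLE (g : ℕ) :
    ∀ (N : Type) [AddCommGroup N] [Module (PowerSeries K) N],
      TorsionXDivisible K N → XRankLE K g N → ∃ a b c : ℕ,
        Nonempty (N ≃ₗ[PowerSeries K] (Fin a → FractionRing (PowerSeries K) ⧸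
          LinearMap.range (Algebra.linearMap (PowerSeries K) (FractionRing (PowerSeries K)))) ×
          (Fin b → FractionRing (PowerSeries K)) × (Fin c → PowerSeries K)) := by
  induction g using Nat.strong_induction_on with
  | h g ih =>
    intro N _ _ hN hg
    by_cases hs : XInfDivisible K N = ⊥
    · obtain ⟨c, ⟨e⟩⟩ := free_of_XInfDivisible_eq_bot hg (fun t ht => by
        have := hN.mem_XInfDivisible (j := 1) (t := t) (by rwa [pow_one])
        rwa [hs, Submodule.mem_bot] at this) hs
      have e₁ : (Fin c → PowerSeries K) ≃ₗ[PowerSeries K]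
          (Fin 0 → FractionRing (PowerSeries K)) × (Fin c → PowerSeries K) :=
        LinearEquiv.uniqueProd.symm
      have e₂ : ((Fin 0 → FractionRing (PowerSeries K)) × (Fin c → PowerSeries K))
          ≃ₗ[PowerSeries K] (Fin 0 → FractionRing (PowerSeries K) ⧸ LinearMap.range
            (Algebra.linearMap (PowerSeries K) (FractionRing (PowerSeries K)))) ×
          (Fin 0 → FractionRing (PowerSeries K)) × (Fin c → PowerSeries K) :=
        LinearEquiv.uniqueProd.symm
      exact ⟨0, 0, c, ⟨(e.trans e₁).trans e₂⟩⟩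
    · obtain ⟨h, h0, hker⟩ := exists_hom_fractionRing hN hs
      obtain ⟨g', rfl, N', hN', hg', ⟨e⟩⟩ := exists_splitting hN hg h h0
      obtain ⟨a, b, c, ⟨e'⟩⟩ := ih g' (Nat.lt_succ_self _) N' hN' hg'
      rcases hker with hker | hker
      · have e₁ := e.trans ((Submodule.quotEquivOfEqBot _ hker).prodCongr e')
        have e₂ := (Fin.consLinearEquiv (PowerSeries K)
          fun _ : Fin (b + 1) => FractionRing (PowerSeries K)).prodCongr
          (LinearEquiv.refl (PowerSeries K) (Fin c → PowerSeries K))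
        exact ⟨a, b + 1, c, ⟨(e₁.trans (prodRotateEquiv _ _ _ _ _)).trans
          ((LinearEquiv.refl (PowerSeries K) _).prodCongr e₂)⟩⟩
      · have e₁ := e.trans ((Submodule.quotEquivOfEq _ _ hker).prodCongr e')
        have e₂ := (Fin.consLinearEquiv (PowerSeries K)
          fun _ : Fin (a + 1) => FractionRing (PowerSeries K) ⧸ LinearMap.range
            (Algebra.linearMap (PowerSeries K) (FractionRing (PowerSeries K)))).prodCongr
          (LinearEquiv.refl (PowerSeries K)
            ((Fin b → FractionRing (PowerSeries K)) × (Fin c → PowerSeries K)))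
        exact ⟨a + 1, b, c, ⟨(e₁.trans (LinearEquiv.prodAssoc _ _ _ _).symm).trans e₂⟩⟩

end PowerSeriesModules

section Rank

theorem DirectSum.IsInternal.exists_projection {S ι M : Type*} [DecidableEq ι] [CommRing S]
    [AddCommGroup M] [Module S M] {gr : ι → Submodule S M} (h : DirectSum.IsInternal gr) (u : ι) :
    ∃ π : M →ₗ[S] gr u, (∀ m : gr u, π m = m) ∧ ∀ v ≠ u, ∀ m ∈ gr v, π m = 0 := by
  let := h.chooseDecomposition
  refine ⟨(DirectSum.component S ι (fun i => gr i) u) ∘ₗ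
    (DirectSum.decomposeLinearEquiv gr).toLinearMap, fun m => ?_, fun v hv m hm => ?_⟩
  · ext
    exact DirectSum.decompose_of_mem_same gr m.2
  · ext
    exact DirectSum.decompose_of_mem_ne gr hm hv

theorem DirectSum.IsInternal.exists_homogeneous_generators {S R ι M : Type*} [DecidableEq ι]
    [CommRing S] [CommRing R] [AddCommGroup M] [Module S M] [Module R M] [Module.Finite R M]
    {gr : ι → Submodule S M} (h : DirectSum.IsInternal gr) :
    ∃ (g : ℕ) (x : Fin g → M) (d : Fin g → ι), (∀ j, x j ∈ gr (d j)) ∧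
      Submodule.span R (Set.range x) = ⊤ := by
  let := h.chooseDecomposition
  have hspan : Submodule.span R {m : M | ∃ u, m ∈ gr u} = ⊤ := by
    refine Submodule.eq_top_iff'.2 fun m => ?_
    classical
    rw [← DirectSum.sum_support_decompose gr m]
    exact Submodule.sum_mem _ fun i _ => Submodule.subset_span ⟨i, Submodule.coe_mem _⟩
  have hfg : (Submodule.span R {m : M | ∃ u, m ∈ gr u}).FG := hspan ▸ Module.Finite.fg_top
  obtain ⟨t, ht, hts⟩ := Submodule.fg_span_iff_fg_span_finset_subset _ |>.1 hfg
  choose d hd using fun m : t => ht m.2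
  refine ⟨t.card, fun j => t.equivFin.symm j, fun j => d (t.equivFin.symm j), fun j => hd _, ?_⟩
  rw [← hspan, hts]
  congr 1
  ext m
  constructor
  · rintro ⟨j, rfl⟩
    exact (t.equivFin.symm j).2
  · intro hm
    exact ⟨t.equivFin ⟨m, hm⟩, by simp⟩

theorem FF.smul_of_tmul (p n : ℕ) (A : Type) [CommRing A] [Fact p.Prime] [CharP A p]
    (M : Type) [AddCommGroup M] [Module (PolyR n A) M] (r s : PolyR n A) (m : M) :
    r • FF.of p n A M (twist p n A s ⊗ₜ[PolyR n A] m) =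
      FF.of p n A M (twist p n A (r * s) ⊗ₜ[PolyR n A] m) := rfl

theorem FF.of_tmul_smul (p n : ℕ) (A : Type) [CommRing A] [Fact p.Prime] [CharP A p]
    (M : Type) [AddCommGroup M] [Module (PolyR n A) M] (r s : PolyR n A) (m : M) :
    FF.of p n A M (twist p n A s ⊗ₜ[PolyR n A] (r • m)) =
      FF.of p n A M (twist p n A (r ^ p * s) ⊗ₜ[PolyR n A] m) :=
  (TensorProduct.smul_tmul r (twist p n A s) m).symm

theorem FF.span_one_tmul {p n : ℕ} {A : Type} [CommRing A] [Fact p.Prime] [CharP A p]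
    {M : Type} [AddCommGroup M] [Module (PolyR n A) M] {ι : Type*} {x : ι → M}
    (hx : Submodule.span (PolyR n A) (Set.range x) = ⊤) :
    Submodule.span (PolyR n A)
      (Set.range fun j => FF.of p n A M (twist p n A 1 ⊗ₜ[PolyR n A] x j)) = ⊤ := by
  have key : ∀ (m : M) (r : PolyR n A), FF.of p n A M (twist p n A r ⊗ₜ[PolyR n A] m) ∈
      Submodule.span (PolyR n A)
        (Set.range fun j => FF.of p n A M (twist p n A 1 ⊗ₜ[PolyR n A] x j)) := by
    intro m r
    have hm : m ∈ Submodule.span (PolyR n A) (Set.range x) := hx ▸ Submodule.mem_top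
    induction hm using Submodule.span_induction generalizing r with
    | mem m hm =>
      obtain ⟨j, rfl⟩ := hm
      have h := Submodule.smul_mem (Submodule.span (PolyR n A)
        (Set.range fun j => FF.of p n A M (twist p n A 1 ⊗ₜ[PolyR n A] x j))) r
        (Submodule.subset_span ⟨j, rfl⟩)
      dsimp only at h
      rw [FF.smul_of_tmul, mul_one] at h
      exact h
    | zero =>
      rw [TensorProduct.tmul_zero]
      exact Submodule.zero_mem _
    | add a b _ _ ha hb =>
      rw [TensorProduct.tmul_add]
      exact Submodule.add_mem _ (ha r) (hb r)
    | smul c a _ ha =>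
      rw [FF.of_tmul_smul]
      exact ha _
  refine Submodule.eq_top_iff'.2 fun z => ?_
  induction z using TensorProduct.induction_on with
  | zero => exact Submodule.zero_mem _
  | add a b ha hb => exact Submodule.add_mem _ ha hb
  | tmul r m => exact key m r

theorem GrMod.FPow_exists_generators {p n : ℕ} {A : Type} [CommRing A] [Fact p.Prime] [CharP A p]
    (U : GrMod p n A) {g : ℕ} (x : Fin g → U.carrier) (d : Fin g → Fin n → ℤ)
    (hx : ∀ j, x j ∈ U.gr (d j)) (hspan : Submodule.span (PolyR n A) (Set.range x) = ⊤) (k : ℕ) :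
    ∃ (y : Fin g → (U.FPow k).carrier) (e : Fin g → Fin n → ℤ),
      (∀ j, y j ∈ (U.FPow k).gr (e j)) ∧ Submodule.span (PolyR n A) (Set.range y) = ⊤ := by
  induction k with
  | zero => exact ⟨x, d, hx, hspan⟩
  | succ k ih =>
    obtain ⟨y, e, hy, hys⟩ := ih
    refine ⟨fun j => FF.of p n A _ (twist p n A 1 ⊗ₜ[PolyR n A] y j), fun j => p • e j,
      fun j => ?_, FF.span_one_tmul hys⟩
    change _ ∈ FF.comp p n A (U.FPow k).carrier (U.FPow k).gr (p • e j)
    refine Submodule.subset_span ⟨1, 0, e j, y j, fun m hm => ?_, hy j, zero_add _, rfl⟩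
    have h1 : m ∈ (MvPolynomial.monomial (0 : Fin n →₀ ℕ) (1 : A)).support := hm
    have h0 : m = 0 := by simpa using MvPolynomial.support_monomial_subset h1
    ext i
    simp [h0]

theorem monomial_smul_mem {n : ℕ} {A : Type} [CommRing A] {M : Type} [AddCommGroup M] [Module A M]
    [Module (PolyR n A) M] [IsScalarTower A (PolyR n A) M] {gr : (Fin n → ℤ) → Submodule A M}
    (hX : ∀ (i : Fin n) (u : Fin n → ℤ), ∀ m ∈ gr u,
      (MvPolynomial.X i : PolyR n A) • m ∈ gr (u + Pi.single i 1))
    (s : Fin n →₀ ℕ) {u : Fin n → ℤ} {m : M} (hm : m ∈ gr u) :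
    (MvPolynomial.monomial s 1 : PolyR n A) • m ∈ gr (u + fun i => (s i : ℤ)) := by
  induction s using Finsupp.induction_linear generalizing u m with
  | zero =>
    have : (u + fun i => (((0 : Fin n →₀ ℕ) i : ℕ) : ℤ)) = u := by ext i; simp
    rw [this]
    change (1 : PolyR n A) • m ∈ gr u
    rwa [one_smul]
  | add s t hs ht =>
    have h1 : (MvPolynomial.monomial (s + t) 1 : PolyR n A) =
        MvPolynomial.monomial s 1 * MvPolynomial.monomial t 1 := by simp
    have h2 : (u + fun i => (((s + t) i : ℕ) : ℤ)) =
        (u + fun i => (t i : ℤ)) + fun i => (s i : ℤ) := by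
      ext i; simp; ring
    rw [h1, h2, mul_smul]
    exact hs (ht hm)
  | single i k =>
    rw [← MvPolynomial.X_pow_eq_monomial]
    induction k with
    | zero =>
      have : (u + fun j => ((Finsupp.single i 0 j : ℕ) : ℤ)) = u := by ext j; simp
      rwa [this, pow_zero, one_smul]
    | succ k ih =>
      have h2 : (u + fun j => ((Finsupp.single i (k + 1) j : ℕ) : ℤ)) =
          (u + fun j => ((Finsupp.single i k j : ℕ) : ℤ)) + Pi.single i 1 := by
        ext j
        by_cases hj : i = j
        · subst hj; simp; ring
        · simp [hj, Ne.symm hj, Finsupp.single_apply]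
      rw [h2, pow_succ', mul_smul]
      exact hX _ _ _ ih

/-- The degree `u` part of a graded module generated by `g` homogeneous elements is generated
by `g` elements. -/
theorem exists_span_component {n : ℕ} {A : Type} [CommRing A] {M : Type} [AddCommGroup M]
    [Module A M] [Module (PolyR n A) M] [IsScalarTower A (PolyR n A) M]
    {gr : (Fin n → ℤ) → Submodule A M} (hgr : DirectSum.IsInternal gr)
    (hX : ∀ (i : Fin n) (u : Fin n → ℤ), ∀ m ∈ gr u,
      (MvPolynomial.X i : PolyR n A) • m ∈ gr (u + Pi.single i 1))
    {g : ℕ} (y : Fin g → M) (d : Fin g → Fin n → ℤ) (hy : ∀ j, y j ∈ gr (d j)) (u : Fin n → ℤ) :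
    ∃ z : Fin g → gr u, ∀ m : gr u, (m : M) ∈ Submodule.span (PolyR n A) (Set.range y) →
      m ∈ Submodule.span A (Set.range z) := by
  obtain ⟨π, hπ, hπ0⟩ := hgr.exists_projection u
  refine ⟨fun j => π ((MvPolynomial.monomial
    (Finsupp.equivFunOnFinite.symm fun i => (u i - d j i).toNat) 1 : PolyR n A) • y j), ?_⟩
  have key : ∀ m ∈ Submodule.span (PolyR n A) (Set.range y), π m ∈ Submodule.span A
      (Set.range fun j => π ((MvPolynomial.monomial
        (Finsupp.equivFunOnFinite.symm fun i => (u i - d j i).toNat) 1 : PolyR n A) • y j)) := by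
    intro m hm
    obtain ⟨c, rfl⟩ := (Submodule.mem_span_range_iff_exists_fun _).1 hm
    rw [map_sum]
    refine Submodule.sum_mem _ fun j _ => ?_
    rw [MvPolynomial.as_sum (c j), Finset.sum_smul, map_sum]
    refine Submodule.sum_mem _ fun s _ => ?_
    have h1 : (MvPolynomial.monomial s ((c j).coeff s) : PolyR n A) =
        (c j).coeff s • MvPolynomial.monomial s 1 := by
      rw [MvPolynomial.smul_monomial, smul_eq_mul, mul_one]
    rw [h1, smul_assoc, map_smul]
    refine Submodule.smul_mem _ _ ?_
    by_cases hs : (d j + fun i => (s i : ℤ)) = u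
    · refine Submodule.subset_span ⟨j, ?_⟩
      have : (Finsupp.equivFunOnFinite.symm fun i => (u i - d j i).toNat) = s := by
        ext i
        subst hs
        simp
      dsimp only
      rw [this]
    · rw [hπ0 _ hs _ (monomial_smul_mem hX s (hy j))]
      exact Submodule.zero_mem _
  intro m hm
  rw [← hπ m]
  exact key m hm

theorem ZGradedFFiniteFModule.exists_finite_rank {p n : ℕ} {A : Type} [CommRing A] [Fact p.Prime]
    [CharP A p] {M : Type} [AddCommGroup M] [Module A M] [Module (PolyR n A) M]
    [IsScalarTower A (PolyR n A) M] {gr : (Fin n → ℤ) → Submodule A M}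
    (hM : ZGradedFFiniteFModule p n A M gr) (u : Fin n → ℤ) :
    ∃ g : ℕ, ∀ (m : ℕ) (v : Fin m → gr u),
      ∃ w : Fin g → gr u, ∀ i, v i ∈ Submodule.span A (Set.range w) := by
  have := hM.gen_fg
  obtain ⟨g, x, d, hx, hspan⟩ :=
    hM.gen_internal.exists_homogeneous_generators (R := PolyR n A)
  refine ⟨g, fun m v => ?_⟩
  have hmono : Monotone fun k => LinearMap.range (hM.toLim k) := by
    refine monotone_nat_of_le_succ fun k => ?_
    rintro _ ⟨x, rfl⟩
    exact ⟨hM.gen.seqMap hM.beta k x, hM.toLim_compat k x⟩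
  choose k z hz using fun i => hM.toLim_surj (v i : M)
  obtain ⟨y, e, hy, hys⟩ := hM.gen.FPow_exists_generators x d hx hspan (Finset.univ.sup k)
  obtain ⟨w, hw⟩ := exists_span_component hM.isInternal hM.smul_X_mem
    (fun j => hM.toLim _ (y j)) e (fun j => hM.toLim_grade _ _ _ (hy j)) u
  refine ⟨w, fun i => hw _ ?_⟩
  have h1 : (v i : M) ∈ LinearMap.range (hM.toLim (Finset.univ.sup k)) :=
    hmono (Finset.le_sup (Finset.mem_univ i)) ⟨z i, hz i⟩
  rw [LinearMap.range_eq_map, ← hys, Submodule.map_span, ← Set.range_comp] at h1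
  exact h1

end Rank

section FrobeniusStructure

/-- An additive map `φ` exhibiting `M` as its own base change along the Frobenius: it is
Frobenius-semilinear, additive maps out of `M` are determined by their values on the elements
`s • φ m`, and balanced biadditive maps in `(s, m)` descend to `M`. -/
structure IsFrobeniusStructure (p : ℕ) {R M : Type*} [CommRing R] [AddCommGroup M] [Module R M]
    (φ : M →+ M) : Prop where
  map_smul : ∀ (r : R) (m : M), φ (r • m) = r ^ p • φ m
  hom_ext : ∀ f g : M →+ M, (∀ (s : R) (m : M), f (s • φ m) = g (s • φ m)) → f = g
  exists_lift : ∀ B : R →+ M →+ M, (∀ (r s : R) (m : M), B (r ^ p * s) m = B s (r • m)) →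
    ∃ T : M →+ M, ∀ (s : R) (m : M), T (s • φ m) = B s m

theorem ZGradedFFiniteFModule.exists_frobeniusStructure {p n : ℕ} {A : Type} [CommRing A]
    [Fact p.Prime] [CharP A p] {M : Type} [AddCommGroup M] [Module A M] [Module (PolyR n A) M]
    [IsScalarTower A (PolyR n A) M] {gr : (Fin n → ℤ) → Submodule A M}
    (hM : ZGradedFFiniteFModule p n A M gr) :
    ∃ φ : M →+ M, IsFrobeniusStructure p (R := PolyR n A) φ := by
  let φ : M →+ M :=
    { toFun := fun m => hM.theta.symm (FF.of p n A M (twist p n A 1 ⊗ₜ[PolyR n A] m))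
      map_zero' := by
        rw [TensorProduct.tmul_zero]
        exact map_zero _
      map_add' := fun a b => by
        rw [TensorProduct.tmul_add]
        exact map_add hM.theta.symm (FF.of p n A M (twist p n A 1 ⊗ₜ[PolyR n A] a))
          (FF.of p n A M (twist p n A 1 ⊗ₜ[PolyR n A] b)) }
  have hφ : ∀ (s : PolyR n A) (m : M),
      s • φ m = hM.theta.symm (FF.of p n A M (twist p n A s ⊗ₜ[PolyR n A] m)) := by
    intro s m
    change s • hM.theta.symm _ = _
    rw [← map_smul, FF.smul_of_tmul, mul_one]
  refine ⟨φ, fun r m => ?_, fun f g hfg => ?_, fun B hB => ?_⟩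
  · rw [hφ]
    change hM.theta.symm _ = _
    rw [FF.of_tmul_smul, mul_one]
  · have key : ∀ (s : PolyR n A) (m : M),
        f (hM.theta.symm (FF.of p n A M (twist p n A s ⊗ₜ[PolyR n A] m))) =
          g (hM.theta.symm (FF.of p n A M (twist p n A s ⊗ₜ[PolyR n A] m))) := by
      intro s m
      rw [← hφ]
      exact hfg s m
    ext m
    obtain ⟨z, rfl⟩ := hM.theta.symm.surjective m
    induction z using TensorProduct.induction_on with
    | zero =>
      have h : hM.theta.symm 0 = 0 := map_zero hM.theta.symm
      exact (congrArg f h).trans ((map_zero f).trans ((map_zero g).symm.trans (congrArg g h).symm))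
    | add a b ha hb =>
      have h : hM.theta.symm (a + b) = hM.theta.symm a + hM.theta.symm b :=
        map_add hM.theta.symm a b
      exact (congrArg f h).trans ((map_add f _ _).trans ((congrArg₂ (· + ·) ha hb).trans
        ((map_add g _ _).symm.trans (congrArg g h).symm)))
    | tmul s m =>
      exact key s m
  · let B' : FrobTwist p n A →+ M →+ M := B
    let T : FrobTwist p n A ⊗[PolyR n A] M →+ M :=
      TensorProduct.liftAddHom B' fun r s m => hB r s m
    let e : M →+ FrobTwist p n A ⊗[PolyR n A] M := hM.theta.toLinearMap.toAddMonoidHom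
    refine ⟨T.comp e, fun s m => ?_⟩
    rw [hφ]
    have h : e (hM.theta.symm (FF.of p n A M (twist p n A s ⊗ₜ[PolyR n A] m))) =
      twist p n A s ⊗ₜ[PolyR n A] m := hM.theta.apply_symm_apply _
    rw [AddMonoidHom.comp_apply, h]
    exact TensorProduct.liftAddHom_tmul _ _ _ _

namespace IsFrobeniusStructure

variable {p : ℕ} {R M : Type*} [CommRing R] [AddCommGroup M] [Module R M] {φ : M →+ M}

theorem iterate_map_smul (h : IsFrobeniusStructure p (R := R) φ) (k : ℕ) (r : R) (m : M) :
    φ^[k] (r • m) = r ^ p ^ k • φ^[k] m := by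
  induction k with
  | zero => simp
  | succ k ih =>
    rw [Function.iterate_succ_apply', ih, h.map_smul, ← pow_mul, ← pow_succ,
      ← Function.iterate_succ_apply' φ]

theorem iterate_hom_ext (h : IsFrobeniusStructure p (R := R) φ) (k : ℕ) (f g : M →+ M)
    (hfg : ∀ (s : R) (m : M), f (s • φ^[k] m) = g (s • φ^[k] m)) : f = g := by
  induction k generalizing f g with
  | zero =>
    ext m
    simpa using hfg 1 m
  | succ k ih =>
    refine h.hom_ext f g fun s m => ?_
    have key := ih (f.comp ((DistribSMul.toAddMonoidHom M s).comp φ))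
      (g.comp ((DistribSMul.toAddMonoidHom M s).comp φ)) fun t m => by
        have := hfg (s * t ^ p) m
        rw [Function.iterate_succ_apply', mul_smul, ← h.map_smul] at this
        exact this
    exact DFunLike.congr_fun key m

theorem exists_iterate_extension [Fact p.Prime] [CharP R p]
    (h : IsFrobeniusStructure p (R := R) φ) (k l : ℕ) (T : R →+ R)
    (hT : ∀ r s : R, T (r ^ p ^ k * s) = r ^ p ^ l * T s) :
    ∃ T' : M →+ M, ∀ (s : R) (m : M), T' (s • φ^[k] m) = T s • φ^[l] m := by
  induction k generalizing T with
  | zero =>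
    refine ⟨{ toFun := fun m => T 1 • φ^[l] m
              map_zero' := by rw [iterate_map_zero, smul_zero]
              map_add' := fun a b => by rw [iterate_map_add, smul_add] }, fun s m => ?_⟩
    have h1 := hT s 1
    rw [pow_zero, pow_one, mul_one] at h1
    change T 1 • φ^[l] (s • m) = T s • φ^[l] m
    rw [h.iterate_map_smul, h1, ← mul_smul, mul_comm]
  | succ k ih =>
    have hex : ∀ s : R, ∃ T' : M →+ M,
        ∀ (r : R) (m : M), T' (r • φ^[k] m) = T (s * r ^ p) • φ^[l] m := fun s =>
      ih (T.comp ((AddMonoidHom.mulLeft s).comp (frobenius R p).toAddMonoidHom)) fun r t => by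
        change T (s * (r ^ p ^ k * t) ^ p) = r ^ p ^ l * T (s * t ^ p)
        rw [← hT, mul_pow, ← pow_mul, ← pow_succ]
        congr 1
        ring
    choose T' hT' using hex
    let B : R →+ M →+ M :=
      { toFun := T'
        map_zero' := h.iterate_hom_ext k _ _ fun r m => by simp [hT']
        map_add' := fun a b => h.iterate_hom_ext k _ _ fun r m => by
          simp [hT', add_mul, add_smul] }
    obtain ⟨T'', hT''⟩ := h.exists_lift B fun r s m => by
      have := h.iterate_hom_ext k (T' (r ^ p * s))
        ((T' s).comp (DistribSMul.toAddMonoidHom M r)) fun t m => by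
          simp only [AddMonoidHom.comp_apply, DistribSMul.toAddMonoidHom_apply, ← mul_smul, hT']
          congr 2
          ring
      exact DFunLike.congr_fun this m
    refine ⟨T'', fun s m => ?_⟩
    rw [Function.iterate_succ_apply', hT'']
    have := hT' s 1 m
    rwa [one_smul, one_pow, mul_one] at this

end IsFrobeniusStructure

/-- On `K⟦X⟧`, the map sending `f` to the series whose `j`-th coefficient is that of
`X ^ (j + q - 1)` in `f` when `q ∣ j`, and `0` otherwise. -/
def powerSeriesLower (K : Type*) [CommRing K] (q : ℕ) : PowerSeries K →+ PowerSeries K where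
  toFun f := PowerSeries.mk fun j => if q ∣ j then PowerSeries.coeff (j + (q - 1)) f else 0
  map_zero' := by ext; simp
  map_add' f g := by
    ext j
    by_cases h : q ∣ j <;> simp [h]

/-- On `K⟦X⟧`, the map dividing by `X` after discarding the monomials whose exponent is a
multiple of `q`. -/
def powerSeriesShift (K : Type*) [CommRing K] (q : ℕ) : PowerSeries K →+ PowerSeries K where
  toFun f := PowerSeries.mk fun j => if q ∣ j + 1 then 0 else PowerSeries.coeff (j + 1) f
  map_zero' := by ext; simp
  map_add' f g := by
    ext j
    by_cases h : q ∣ j + 1 <;> simp [h]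

theorem powerSeriesLower_add_shift {K : Type*} [CommRing K] (q : ℕ) (f : PowerSeries K) :
    powerSeriesLower K q (PowerSeries.X ^ (q - 1) * f) +
      PowerSeries.X * powerSeriesShift K q f = f := by
  ext j
  cases j with
  | zero => simp [powerSeriesLower, PowerSeries.coeff_X_pow_mul']
  | succ j =>
    by_cases h : q ∣ j + 1 <;>
      simp [PowerSeries.coeff_X_pow_mul', powerSeriesLower, powerSeriesShift,
        PowerSeries.coeff_succ_X_mul, h]

/-- An additive endomorphism of `K⟦X⟧` commuting with `K` and with `X ^ q`, where `q` is a power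
of the characteristic, is linear over `q`-th powers. -/
theorem PowerSeries.map_pow_char_pow_mul {K : Type*} [CommRing K] (p k : ℕ) [Fact p.Prime]
    [CharP K p] (T : PowerSeries K →+ PowerSeries K)
    (hC : ∀ (c : K) (f : PowerSeries K), T (PowerSeries.C c * f) = PowerSeries.C c * T f)
    (hX : ∀ f : PowerSeries K, T (PowerSeries.X ^ p ^ k * f) = PowerSeries.X ^ p ^ k * T f)
    (a f : PowerSeries K) : T (a ^ p ^ k * f) = a ^ p ^ k * T f := by
  have : CharP (PowerSeries K) p := charP_of_injective_ringHom (PowerSeries.C_injective (R := K)) p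
  have key : ∀ (N : ℕ) (a : PowerSeries K),
      (PowerSeries.X : PowerSeries K) ^ N ∣ T (a ^ p ^ k * f) - a ^ p ^ k * T f := by
    intro N
    induction N with
    | zero => exact fun a => by simp
    | succ N ih =>
      intro a
      obtain ⟨b, hb⟩ := PowerSeries.X_dvd_iff.2
        (show PowerSeries.constantCoeff (a - PowerSeries.C (PowerSeries.constantCoeff a)) = 0
          by simp)
      have ha : a ^ p ^ k = PowerSeries.C (PowerSeries.constantCoeff a ^ p ^ k) +
          PowerSeries.X ^ p ^ k * b ^ p ^ k := by
        rw [← mul_pow, ← hb, map_pow, ← add_pow_char_pow, add_sub_cancel]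
      have h1 : T (a ^ p ^ k * f) - a ^ p ^ k * T f =
          PowerSeries.X ^ p ^ k * (T (b ^ p ^ k * f) - b ^ p ^ k * T f) := by
        rw [ha, add_mul, map_add, hC, mul_assoc, hX]
        ring
      rw [h1, pow_succ']
      exact mul_dvd_mul (dvd_pow_self _ (pow_pos (Fact.out : p.Prime).pos k).ne') (ih b)
  ext j
  have := PowerSeries.X_pow_dvd_iff.1 (key (j + 1) a) j (Nat.lt_succ_self j)
  rwa [map_sub, sub_eq_zero] at this

theorem powerSeriesLower_pow_mul {K : Type*} [CommRing K] (p k : ℕ) [Fact p.Prime] [CharP K p]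
    (a f : PowerSeries K) :
    powerSeriesLower K (p ^ k) (a ^ p ^ k * f) = a ^ p ^ k * powerSeriesLower K (p ^ k) f := by
  have hq : 0 < p ^ k := pow_pos (Fact.out : p.Prime).pos k
  refine PowerSeries.map_pow_char_pow_mul p k _ (fun c f => ?_) (fun f => ?_) a f
  · ext j
    by_cases h : p ^ k ∣ j <;> simp [powerSeriesLower, h]
  · generalize p ^ k = q at hq
    ext j
    by_cases h : q ∣ j
    · obtain ⟨i, rfl⟩ := h
      cases i with
      | zero =>
        have h0 : ¬ q ≤ q - 1 := by lia
        have h1 : ¬ q ≤ 0 := by lia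
        simp [powerSeriesLower, PowerSeries.coeff_X_pow_mul', h0, h1]
      | succ i =>
        have h0 : q * (i + 1) + (q - 1) - q = q * (i + 1) - q + (q - 1) := by
          rw [mul_add]; lia
        have h1 : q ≤ q * (i + 1) + (q - 1) := by rw [mul_add]; lia
        have h2 : q ≤ q * (i + 1) := by rw [mul_add]; lia
        have h3 : q ∣ q * (i + 1) - q := Nat.dvd_sub (dvd_mul_right _ _) dvd_rfl
        simp [powerSeriesLower, PowerSeries.coeff_X_pow_mul', h0, h1, h2, h3]
    · have h1 : ∀ _ : q ≤ j, ¬ q ∣ j - q := fun hj hd =>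
        h (Nat.sub_add_cancel hj ▸ dvd_add hd dvd_rfl)
      simp +contextual [powerSeriesLower, PowerSeries.coeff_X_pow_mul', h, h1]

theorem powerSeriesShift_pow_mul {K : Type*} [CommRing K] (p k : ℕ) [Fact p.Prime] [CharP K p]
    (a f : PowerSeries K) :
    powerSeriesShift K (p ^ k) (a ^ p ^ k * f) = a ^ p ^ k * powerSeriesShift K (p ^ k) f := by
  have hq : 0 < p ^ k := pow_pos (Fact.out : p.Prime).pos k
  refine PowerSeries.map_pow_char_pow_mul p k _ (fun c f => ?_) (fun f => ?_) a f
  · ext j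
    by_cases h : p ^ k ∣ j + 1 <;> simp [powerSeriesShift, h]
  · generalize p ^ k = q at hq
    ext j
    rcases lt_trichotomy (j + 1) q with hj | hj | hj
    · have h1 : ¬ q ≤ j := by lia
      have h2 : ¬ q ≤ j + 1 := by lia
      simp [powerSeriesShift, PowerSeries.coeff_X_pow_mul', h1, h2]
    · have h1 : ¬ q ≤ j := by lia
      simp [powerSeriesShift, PowerSeries.coeff_X_pow_mul', h1, hj]
    · obtain ⟨i, rfl⟩ := Nat.exists_eq_add_of_le (Nat.lt_succ_iff.1 hj)
      have h1 : q ≤ q + i + 1 := by lia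
      have h2 : q + i + 1 - q = i + 1 := by lia
      have h3 : q ∣ q + i + 1 ↔ q ∣ i + 1 := by
        rw [add_assoc]; exact Nat.dvd_add_right dvd_rfl
      simp [powerSeriesShift, PowerSeries.coeff_X_pow_mul', h1, h2, h3]

/-- The coefficientwise extension of an additive endomorphism of `A` to polynomials. -/
def MvPolynomial.mapAddHom (σ : Type*) {A : Type*} [CommRing A] (T : A →+ A) :
    MvPolynomial σ A →+ MvPolynomial σ A where
  toFun := AddMonoidAlgebra.map T
  map_zero' := by ext; simp [MvPolynomial.coeff]
  map_add' f g := by ext; simp [MvPolynomial.coeff]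

theorem MvPolynomial.mapAddHom_monomial {σ A : Type*} [CommRing A] (T : A →+ A) (s : σ →₀ ℕ)
    (a : A) : MvPolynomial.mapAddHom σ T (MvPolynomial.monomial s a) =
      MvPolynomial.monomial s (T a) :=
  AddMonoidAlgebra.map_single T a s

theorem MvPolynomial.mapAddHom_pow_char_pow_mul {σ A : Type*} [CommRing A] (p k : ℕ)
    [Fact p.Prime] [CharP A p] (T : A →+ A) (hT : ∀ a b : A, T (a ^ p ^ k * b) = a ^ p ^ k * T b)
    (r s : MvPolynomial σ A) :
    MvPolynomial.mapAddHom σ T (r ^ p ^ k * s) = r ^ p ^ k * MvPolynomial.mapAddHom σ T s := by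
  induction r using MvPolynomial.induction_on' with
  | add f g hf hg => rw [add_pow_char_pow, add_mul, map_add, hf, hg, add_mul]
  | monomial u a =>
    induction s using MvPolynomial.induction_on' with
    | add f g hf hg => rw [mul_add, map_add, hf, hg, map_add, mul_add]
    | monomial v b =>
      rw [MvPolynomial.monomial_pow, MvPolynomial.monomial_mul, MvPolynomial.mapAddHom_monomial,
        MvPolynomial.mapAddHom_monomial, MvPolynomial.monomial_mul, hT]

theorem ZGradedFFiniteFModule.exists_X_smul_eq {p n : ℕ} [Fact p.Prime] {K : Type} [Field K]
    [CharP K p] {M : Type} [AddCommGroup M] [Module (PowerSeries K) M]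
    [Module (PolyR n (PowerSeries K)) M]
    [IsScalarTower (PowerSeries K) (PolyR n (PowerSeries K)) M]
    {gr : (Fin n → ℤ) → Submodule (PowerSeries K) M}
    (hM : ZGradedFFiniteFModule p n (PowerSeries K) M gr) (j : ℕ) (m : M)
    (hm : (PowerSeries.X : PowerSeries K) ^ j • m = 0) :
    ∃ m' : M, (PowerSeries.X : PowerSeries K) • m' = m := by
  obtain ⟨φ, hφ⟩ := hM.exists_frobeniusStructure
  obtain ⟨L, hL⟩ := hφ.exists_iterate_extension j j
    (MvPolynomial.mapAddHom (Fin n) (powerSeriesLower K (p ^ j)))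
    (MvPolynomial.mapAddHom_pow_char_pow_mul p j _ (powerSeriesLower_pow_mul p j))
  obtain ⟨D, hD⟩ := hφ.exists_iterate_extension j j
    (MvPolynomial.mapAddHom (Fin n) (powerSeriesShift K (p ^ j)))
    (MvPolynomial.mapAddHom_pow_char_pow_mul p j _ (powerSeriesShift_pow_mul p j))
  have key : L.comp (DistribSMul.toAddMonoidHom M ((PowerSeries.X : PowerSeries K) ^ (p ^ j - 1))) +
      (DistribSMul.toAddMonoidHom M (PowerSeries.X : PowerSeries K)).comp D =
      AddMonoidHom.id M := by
    refine hφ.iterate_hom_ext j _ _ fun s m => ?_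
    simp only [AddMonoidHom.add_apply, AddMonoidHom.comp_apply, DistribSMul.toAddMonoidHom_apply,
      AddMonoidHom.id_apply, ← smul_assoc, hL, hD, ← add_smul]
    congr 1
    induction s using MvPolynomial.induction_on' with
    | add f g hf hg =>
      rw [smul_add, map_add, map_add, smul_add, add_add_add_comm, hf, hg]
    | monomial u a =>
      rw [MvPolynomial.smul_monomial, MvPolynomial.mapAddHom_monomial,
        MvPolynomial.mapAddHom_monomial, MvPolynomial.smul_monomial, ← map_add, smul_eq_mul,
        smul_eq_mul, powerSeriesLower_add_shift]
  have hj : j ≤ p ^ j - 1 :=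
    Nat.le_sub_one_of_lt (Nat.lt_pow_self (Fact.out : p.Prime).one_lt)
  have hm' : (PowerSeries.X : PowerSeries K) ^ (p ^ j - 1) • m = 0 := by
    rw [← Nat.sub_add_cancel hj, pow_add, mul_smul, hm, smul_zero]
  have h := DFunLike.congr_fun key m
  simp only [AddMonoidHom.add_apply, AddMonoidHom.comp_apply, DistribSMul.toAddMonoidHom_apply,
    AddMonoidHom.id_apply, hm', map_zero, zero_add] at h
  exact ⟨D m, h⟩

theorem ZGradedFFiniteFModule.torsionXDivisible {p n : ℕ} [Fact p.Prime] {K : Type} [Field K]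
    [CharP K p] {M : Type} [AddCommGroup M] [Module (PowerSeries K) M]
    [Module (PolyR n (PowerSeries K)) M]
    [IsScalarTower (PowerSeries K) (PolyR n (PowerSeries K)) M]
    {gr : (Fin n → ℤ) → Submodule (PowerSeries K) M}
    (hM : ZGradedFFiniteFModule p n (PowerSeries K) M gr) (u : Fin n → ℤ) :
    TorsionXDivisible K (gr u) := by
  intro j t ht
  obtain ⟨m, hm⟩ := hM.exists_X_smul_eq j t (by rw [← Submodule.coe_smul, ht, Submodule.coe_zero])
  obtain ⟨π, hπ, -⟩ := hM.isInternal.exists_projection u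
  exact ⟨π m, by rw [← map_smul, hm, hπ]⟩

end FrobeniusStructure

/-- **Theorem D / Structure theorem.** Let `K` be a field of characteristic
`p > 0`, `A = K[[Y]]`, `Q(A)` its fraction field, and `M` a `ℤⁿ`-graded `F`-finite `F`-module
over `R = A[X₁,…,Xₙ]`.  Then for every `u ∈ ℤⁿ` there are `a(u), b(u), c(u) ∈ ℕ` with
`M_u ≅ E(A/YA)^{a(u)} ⊕ Q(A)^{b(u)} ⊕ A^{c(u)}` as `A`-modules, where
`E(A/YA) ≅ Q(A)/A`. -/
theorem structure_theorem_components
    (p n : ℕ) [Fact p.Prime] (K : Type) [Field K] [CharP K p]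
    (M : Type) [AddCommGroup M] [Module (PowerSeries K) M]
    [Module (PolyR n (PowerSeries K)) M]
    [IsScalarTower (PowerSeries K) (PolyR n (PowerSeries K)) M]
    (gr : (Fin n → ℤ) → Submodule (PowerSeries K) M)
    (hM : ZGradedFFiniteFModule p n (PowerSeries K) M gr) :
    ∀ u : Fin n → ℤ, ∃ a b c : ℕ,
      Nonempty (↥(gr u) ≃ₗ[PowerSeries K]
        ((Fin a → QmodA K) × (Fin b → QA K) × (Fin c → PowerSeries K))) := by
  intro u
  obtain ⟨g, hg⟩ := hM.exists_finite_rank u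
  exact exists_equiv_of_XRankLE g (gr u) (hM.torsionXDivisible u)
    (XRankLE.of_finite_subsets hg)
end
end

section
/- Let p be a prime number, e ≥ 1 an integer, and t an integer not divisible by p. Then p does not divide C(p^e·t − 1, p^e) + 1, where C(x, r) denotes the generalized integer binomial coefficient. -/
set_option maxHeartbeats 1000000
set_option synthInstance.maxHeartbeats 1000000

/-- Modulo a prime `p`, adding `p ^ e` to `x` increases `C(x, p ^ e)` by one. -/
theorem cast_choose_add_prime_pow (p : ℕ) [Fact p.Prime] (e : ℕ) (x : ℤ) :
    ((Ring.choose (x + (p : ℤ) ^ e) (p ^ e) : ℤ) : ZMod p) =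
      ((Ring.choose x (p ^ e) : ℤ) : ZMod p) + 1 := by
  have hp : p.Prime := Fact.out
  have hpos : p ^ e ≠ 0 := pow_ne_zero _ hp.ne_zero
  have hchoose (j : ℕ) : Ring.choose ((p : ℤ) ^ e) j = ((p ^ e).choose j : ℤ) := by
    rw [← Nat.cast_pow, Ring.choose_natCast]
  rw [Ring.add_choose_eq (p ^ e) (Commute.all x _), Int.cast_sum,
    Finset.sum_eq_add (p ^ e, 0) (0, p ^ e)]
  · simp [hchoose]
  · exact fun h => hpos (congrArg Prod.fst h)
  · rintro ⟨i, j⟩ hij ⟨h₁, h₂⟩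
    rw [Finset.HasAntidiagonal.mem_antidiagonal] at hij
    have hj₀ : j ≠ 0 := by
      rintro rfl
      exact h₁ (Prod.ext hij rfl)
    have hj₁ : j ≠ p ^ e := by
      rintro rfl
      exact h₂ (Prod.ext (Nat.add_eq_right.1 hij) rfl)
    rw [Int.cast_mul, hchoose, Int.cast_natCast,
      (ZMod.natCast_eq_zero_iff _ _).2 (hp.dvd_choose_pow hj₀ hj₁), mul_zero]
  · simp
  · simp

/-- Modulo a prime `p`, `C(pᵉt - 1, pᵉ)` is congruent to `t - 1`. -/
theorem cast_choose_prime_pow_mul_sub_one (p : ℕ) [Fact p.Prime] (e : ℕ) (t : ℤ) :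
    ((Ring.choose ((p : ℤ) ^ e * t - 1) (p ^ e) : ℤ) : ZMod p) = t - 1 := by
  have hstep (s : ℤ) : ((Ring.choose ((p : ℤ) ^ e * (s + 1) - 1) (p ^ e) : ℤ) : ZMod p) =
      ((Ring.choose ((p : ℤ) ^ e * s - 1) (p ^ e) : ℤ) : ZMod p) + 1 := by
    rw [← cast_choose_add_prime_pow]
    ring_nf
  induction t using Int.inductionOn' (b := 1) with
  | zero =>
    have hpos : 0 < p ^ e := pow_pos (Fact.out : p.Prime).pos e
    have h : (p : ℤ) ^ e * 1 - 1 = ((p ^ e - 1 : ℕ) : ℤ) := by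
      push_cast [Nat.cast_sub hpos]
      ring
    rw [h, Ring.choose_natCast, Nat.choose_eq_zero_of_lt (by lia)]
    simp
  | succ s _ ih =>
    rw [hstep, ih]
    push_cast
    ring
  | pred s _ ih =>
    have h := hstep (s - 1)
    rw [sub_add_cancel, ih] at h
    push_cast
    linear_combination -h

/-- **Lemma 2.6, [ST-25, Lemma 4.3].** If `p` is a prime, `e ≥ 1` and `p ∤ t`,
then `p` does not divide `C(pᵉt - 1, pᵉ) + 1`, where `C(x, r) = x(x-1)⋯(x-r+1)/r!` is the
generalized integer binomial coefficient (`Ring.choose` on `ℤ`). -/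
theorem prime_not_dvd_choose_sub_one_add_one
    (p : ℕ) (hp : p.Prime) (e : ℕ) (he : 1 ≤ e) (t : ℤ) (ht : ¬ (p : ℤ) ∣ t) :
    ¬ (p : ℤ) ∣ (Ring.choose ((p : ℤ) ^ e * t - 1) (p ^ e) + 1) := by
  have : Fact p.Prime := ⟨hp⟩
  rw [← ZMod.intCast_zmod_eq_zero_iff_dvd] at ht ⊢
  push_cast
  rwa [cast_choose_prime_pow_mul_sub_one, sub_add_cancel]
end

section
/- Let p be a prime number, e ≥ 0 an integer, and t an integer not divisible by p. Then p does not divide C(p^e·t, p^e), where C(x, r) denotes the generalized integer binomial coefficient. -/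
set_option maxHeartbeats 1000000
set_option synthInstance.maxHeartbeats 1000000

lemma choose_add_prime_pow_modEq {p : ℕ} (hp : p.Prime) (e : ℕ) (x : ℤ) :
    Ring.choose (x + (p : ℤ) ^ e) (p ^ e) ≡ Ring.choose x (p ^ e) + 1 [ZMOD p] := by
  have hpos : p ^ e ≠ 0 := pow_ne_zero e hp.ne_zero
  obtain ⟨m, hm⟩ := Nat.exists_eq_succ_of_ne_zero hpos
  have hvand := Ring.add_choose_eq (p ^ e) (Commute.all x ((p : ℤ) ^ e))
  rw [Finset.Nat.sum_antidiagonal_eq_sum_range_succ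
    (fun i j ↦ Ring.choose x i * Ring.choose ((p : ℤ) ^ e) j), Finset.sum_range_succ] at hvand
  conv at hvand =>
    rhs; lhs; rw [hm, Nat.succ_eq_add_one, Finset.sum_range_succ', ← Nat.succ_eq_add_one, ← hm]
  have hcast (k : ℕ) : Ring.choose ((p : ℤ) ^ e) k = ((p ^ e).choose k : ℕ) := by
    rw [← Nat.cast_pow, Ring.choose_natCast]
  simp only [hcast, Nat.sub_self, Nat.sub_zero, Nat.choose_zero_right, Nat.choose_self,
    Ring.choose_zero_right, Nat.cast_one, mul_one] at hvand
  rw [hvand, Int.modEq_comm, Int.modEq_iff_dvd]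
  ring_nf
  refine Finset.dvd_sum fun i hi ↦ Dvd.dvd.mul_left ?_ _
  rw [Finset.mem_range] at hi
  exact Int.natCast_dvd_natCast.mpr (hp.dvd_choose_pow (by lia) (by lia))

lemma choose_prime_pow_mul_modEq {p : ℕ} (hp : p.Prime) (e : ℕ) (t : ℤ) :
    Ring.choose ((p : ℤ) ^ e * t) (p ^ e) ≡ t [ZMOD p] := by
  induction t with
  | zero => rw [mul_zero, Ring.choose_zero_pos ℤ (pow_pos hp.pos e)]
  | succ n ih =>
    rw [mul_add, mul_one]
    exact (choose_add_prime_pow_modEq hp e _).trans (ih.add_right 1)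
  | pred n ih =>
    have h := choose_add_prime_pow_modEq hp e ((p : ℤ) ^ e * (-n - 1))
    rw [show (p : ℤ) ^ e * (-n - 1) + (p : ℤ) ^ e = (p : ℤ) ^ e * -n by ring] at h
    simpa using (h.symm.trans ih).sub_right 1

/-- If `p` is a prime, `e ≥ 0` and `p ∤ t`, then `p` does not divide
`C(pᵉt, pᵉ)`, where `C(x, r) = x(x-1)⋯(x-r+1)/r!` is the generalized integer binomial
coefficient (`Ring.choose` on `ℤ`). -/
theorem prime_not_dvd_choose
    (p : ℕ) (hp : p.Prime) (e : ℕ) (t : ℤ) (ht : ¬ (p : ℤ) ∣ t) :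
    ¬ (p : ℤ) ∣ (Ring.choose ((p : ℤ) ^ e * t) (p ^ e)) := by
  rwa [(choose_prime_pow_mul_modEq hp e t).dvd_iff]
end

section
/- Let K be a field, A = K[[Y]] the formal power series ring in one variable, and N an A-module on which multiplication by Y is injective and such that dim_K N/YN is finite. Let L = ⋂_{n≥1} YⁿN. Then N/L is a finitely generated free A-module of rank equal to dim_K N/YN, the inclusion L → N splits, so N ≅ L ⊕ A^{dim_K N/YN} as A-modules, and multiplication by Y is bijective on L (so L is a module over the fraction field Q(A) of A). -/
set_option maxHeartbeats 1000000
set_option synthInstance.maxHeartbeats 1000000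

open PowerSeries in
/-- If `x ∈ N` and `f : A^d → N` hits every class modulo `X`, then `x` is congruent to an element
of the range of `f` modulo `⋂ Xⁿ N`. -/
theorem exists_sub_mem_X_pow_smul {K N : Type*} [Field K] [AddCommGroup N] [Module K⟦X⟧ N]
    {ι : Type*} (f : (ι → K⟦X⟧) →ₗ[K⟦X⟧] N)
    (hf : ∀ x : N, ∃ (c : ι → K) (y : N), x = f (fun i => C (c i)) + (X : K⟦X⟧) • y) (x : N) :
    ∃ a : ι → K⟦X⟧, ∀ n : ℕ, ∃ y : N, (X : K⟦X⟧) ^ n • y = x - f a := by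
  choose c y hy using hf
  let s : ℕ → N := fun n => y^[n] x
  let a : ℕ → ι → K⟦X⟧ := fun n i => mk fun m => c (s (n + m)) i
  have ha (n : ℕ) : a n = (fun i => C (c (s n) i)) + (X : K⟦X⟧) • a (n + 1) := by
    ext i m
    cases m with
    | zero => simp [a]
    | succ m => simp [a, coeff_succ_X_mul, add_assoc, add_comm 1 m]
  refine ⟨a 0, fun n => ⟨s n - f (a n), ?_⟩⟩
  induction n with
  | zero => simp [s]
  | succ n ih =>
    have hs : s n = f (fun i => C (c (s n) i)) + (X : K⟦X⟧) • s (n + 1) := by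
      simpa only [s, Function.iterate_succ_apply'] using hy (s n)
    rw [← ih, pow_succ, mul_smul]
    congr 1
    rw [ha n, map_add, map_smul, smul_sub, ← sub_sub, sub_eq_of_eq_add' hs]

open PowerSeries in
/-- If `f : A^d → N` is injective modulo `X` and `X` is a nonzerodivisor on `N`, then no nonzero
element of `A^d` is mapped into `⋂ Xⁿ N`. -/
theorem eq_zero_of_forall_mem_X_pow_smul {K N : Type*} [Field K] [AddCommGroup N]
    [Module K⟦X⟧ N] (hinj : Function.Injective fun x : N => (X : K⟦X⟧) • x)
    {ι : Type*} (f : (ι → K⟦X⟧) →ₗ[K⟦X⟧] N)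
    (hf : ∀ (a : ι → K⟦X⟧) (y : N), (X : K⟦X⟧) • y = f a → ∀ i, constantCoeff (a i) = 0)
    (a : ι → K⟦X⟧) (ha : ∀ n : ℕ, ∃ y : N, (X : K⟦X⟧) ^ n • y = f a) : a = 0 := by
  have key (n : ℕ) : ∀ a : ι → K⟦X⟧, (∃ y : N, (X : K⟦X⟧) ^ n • y = f a) →
      ∀ i, (X : K⟦X⟧) ^ n ∣ a i := by
    induction n with
    | zero => simp
    | succ n ih =>
      rintro a ⟨y, hy⟩ i
      rw [pow_succ', mul_smul] at hy
      choose b hb using fun i => X_dvd_iff.2 (hf a _ hy i)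
      obtain rfl : a = (X : K⟦X⟧) • b := funext hb
      rw [map_smul] at hy
      rw [pow_succ']
      exact mul_dvd_mul_left _ (ih b ⟨y, hinj hy⟩ i)
  ext i m
  simpa using X_pow_dvd_iff.1 (key (m + 1) a (ha _) i) m m.lt_succ_self

/-- Let `K` be a field, `A = K[[Y]]` (with `Y = X` the power series
variable), and `N` an `A`-module on which multiplication by `Y` is injective and with
`dim_K N/YN` finite.  Let `L = ⋂_{k ≥ 1} YᵏN` and `d = dim_K N/YN`.  Then `N/L` is a finitely
generated free `A`-module of rank `d`, the inclusion `L → N` splits, `N ≅ L ⊕ A^d` as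
`A`-modules, and multiplication by `Y` is bijective on `L` (so that `L` is a module over the
fraction field `Q(A)`). -/
theorem splitting_off_free_part
    (K : Type) [Field K] (N : Type) [AddCommGroup N]
    [Module (PowerSeries K) N] [Module K N] [IsScalarTower K (PowerSeries K) N]
    (hinj : Function.Injective fun x : N => (PowerSeries.X : PowerSeries K) • x)
    (hfin : FiniteDimensional K
      (N ⧸ LinearMap.range (LinearMap.lsmul (PowerSeries K) N (PowerSeries.X : PowerSeries K))))
    (L : Submodule (PowerSeries K) N)
    (hL : L = ⨅ k : ℕ, LinearMap.range
      (LinearMap.lsmul (PowerSeries K) N ((PowerSeries.X : PowerSeries K) ^ (k + 1))))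
    (d : ℕ)
    (hd : d = Module.finrank K
      (N ⧸ LinearMap.range (LinearMap.lsmul (PowerSeries K) N (PowerSeries.X : PowerSeries K)))) :
    Nonempty ((N ⧸ L) ≃ₗ[PowerSeries K] (Fin d → PowerSeries K)) ∧
    (∃ π : N →ₗ[PowerSeries K] ↥L, π.comp L.subtype = LinearMap.id) ∧
    Nonempty (N ≃ₗ[PowerSeries K] (↥L × (Fin d → PowerSeries K))) ∧
    (∀ x ∈ L, (PowerSeries.X : PowerSeries K) • x ∈ L) ∧
    (∀ x ∈ L, ∃ y ∈ L, (PowerSeries.X : PowerSeries K) • y = x) ∧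
    (∀ x ∈ L, ∀ y ∈ L,
      (PowerSeries.X : PowerSeries K) • x = (PowerSeries.X : PowerSeries K) • y → x = y) := by
  set R := LinearMap.range
    (LinearMap.lsmul (PowerSeries K) N (PowerSeries.X : PowerSeries K))
  have memL (x : N) : x ∈ L ↔ ∀ n : ℕ, ∃ y : N, (PowerSeries.X : PowerSeries K) ^ n • y = x := by
    rw [hL, Submodule.mem_iInf]
    refine ⟨fun h n => ?_, fun h k => h (k + 1)⟩
    obtain ⟨y, hy⟩ := h n
    exact ⟨(PowerSeries.X : PowerSeries K) • y, by rw [← mul_smul, ← pow_succ]; exact hy⟩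
  have memR (x : N) : Submodule.Quotient.mk (p := R) x = 0 ↔
      ∃ y : N, (PowerSeries.X : PowerSeries K) • y = x := by
    rw [Submodule.Quotient.mk_eq_zero]
    rfl
  let b := Module.finBasisOfFinrankEq K (N ⧸ R) hd.symm
  choose v hv using fun i => Submodule.Quotient.mk_surjective R (b i)
  let f : (Fin d → PowerSeries K) →ₗ[PowerSeries K] N :=
    Fintype.linearCombination (PowerSeries K) v
  have smul_mk (p : PowerSeries K) (x : N) : Submodule.Quotient.mk (p := R) (p • x) =
      PowerSeries.constantCoeff p • Submodule.Quotient.mk (p := R) x := by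
    rw [← Submodule.Quotient.mk_smul, ← sub_eq_zero, ← Submodule.Quotient.mk_sub, memR]
    obtain ⟨q, hq⟩ := PowerSeries.X_dvd_iff.2
      (show PowerSeries.constantCoeff (p - PowerSeries.C (PowerSeries.constantCoeff p)) = 0 by simp)
    refine ⟨q • x, ?_⟩
    rw [← mul_smul, ← hq, sub_smul, ← algebraMap_smul (PowerSeries K)
      (PowerSeries.constantCoeff p) x]
    rfl
  have mk_f (a : Fin d → PowerSeries K) : Submodule.Quotient.mk (p := R) (f a) =
      ∑ i, PowerSeries.constantCoeff (a i) • b i := by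
    rw [Fintype.linearCombination_apply, ← Submodule.mkQ_apply, map_sum]
    simp only [Submodule.mkQ_apply, smul_mk, hv]
  have hspan (x : N) : ∃ (c : Fin d → K) (y : N),
      x = f (fun i => PowerSeries.C (c i)) + (PowerSeries.X : PowerSeries K) • y := by
    let c : Fin d → K := fun i => b.repr (Submodule.Quotient.mk x) i
    obtain ⟨y, hy⟩ := (memR (x - f fun i => PowerSeries.C (c i))).1 (by
      rw [Submodule.Quotient.mk_sub, mk_f, sub_eq_zero]
      simp [c, b.sum_repr])
    exact ⟨c, y, by rw [hy]; abel⟩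
  have hindep (a : Fin d → PowerSeries K) (y : N)
      (hy : (PowerSeries.X : PowerSeries K) • y = f a) (i : Fin d) :
      PowerSeries.constantCoeff (a i) = 0 :=
    Fintype.linearIndependent_iff.1 b.linearIndependent _
      ((mk_f a).symm.trans ((memR _).2 ⟨y, hy⟩)) i
  have hzero (a : Fin d → PowerSeries K) (ha : f a ∈ L) : a = 0 :=
    eq_zero_of_forall_mem_X_pow_smul hinj f hindep a ((memL _).1 ha)
  have hf_inj : Function.Injective f :=
    (injective_iff_map_eq_zero f).2 fun a ha => hzero a (ha ▸ L.zero_mem)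
  have hcompl : IsCompl L (LinearMap.range f) := by
    refine ⟨Submodule.disjoint_def.2 ?_, codisjoint_iff.2 (eq_top_iff.2 fun x _ => ?_)⟩
    · rintro _ hx ⟨a, rfl⟩
      rw [hzero a hx, map_zero]
    · obtain ⟨a, ha⟩ := exists_sub_mem_X_pow_smul f hspan x
      exact Submodule.mem_sup.2 ⟨x - f a, (memL _).2 ha, f a, ⟨a, rfl⟩, sub_add_cancel _ _⟩
  let e := LinearEquiv.ofInjective f hf_inj
  refine ⟨⟨(Submodule.quotientEquivOfIsCompl L _ hcompl).trans e.symm⟩,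
    ⟨L.projectionOnto _ hcompl, Submodule.projectionOnto_comp_subtype hcompl⟩,
    ⟨(Submodule.prodEquivOfIsCompl L _ hcompl).symm.trans
      ((LinearEquiv.refl _ _).prodCongr e.symm)⟩,
    fun x hx => L.smul_mem _ hx, fun x hx => ?_, fun x _ y _ h => hinj h⟩
  obtain ⟨y, hy⟩ := (memL x).1 hx 1
  rw [pow_one] at hy
  refine ⟨y, (memL y).2 fun n => ?_, hy⟩
  obtain ⟨z, hz⟩ := (memL x).1 hx (n + 1)
  exact ⟨z, hinj (by simp only [← mul_smul, ← pow_succ', hz, hy])⟩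
end
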